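/- arXiv:2409.04957 — 3 statements merged into one kernel-verified Lean document; each statement's English description precedes it below -/
import Mathlib

section
/- Let n ≥ 1 and let ≤ be a partial order on Fin n such that for every index i with i+1 < n, the elements i and i+1 are comparable (every fence poset — a poset whose Hasse diagram is a path visiting 0, 1, …, n−1 in order — satisfies this). If I₁ and I₂ are lower sets of (Fin n, ≤) admitting no switching position, i.e. there is no index i with (i ∈ I₁ ↔ i ∈ I₂), then either (I₁ = Fin n and I₂ = ∅) or (I₁ = ∅ and I₂ = Fin n). -/
/-!
Lemma 3.10 of the paper: given order ideals `I₁`, `I₂` of (isomorphic) fence posets,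
identified via a common chronological indexing `0, 1, …, n-1` (so that consecutive
elements are comparable), a switching position — an index `i` with `i ∈ I₁ ↔ i ∈ I₂` —
exists unless `I₁` is the whole poset and `I₂ = ∅`, or vice versa.

The partial order is given by an explicit relation `le` on `Fin n` together with the
partial-order axioms, and the hypothesis that any two chronologically consecutive
elements are comparable.
-/

theorem fence_switching_position_exists
    (n : ℕ) (hn : 1 ≤ n)
    (le : Fin n → Fin n → Prop)
    (hrefl : ∀ i, le i i)
    (hantisymm : ∀ i j, le i j → le j i → i = j)
    (htrans : ∀ i j k, le i j → le j k → le i k)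
    (hcomp : ∀ i : Fin n, ∀ h : (i : ℕ) + 1 < n,
      le i ⟨(i : ℕ) + 1, h⟩ ∨ le ⟨(i : ℕ) + 1, h⟩ i)
    (I₁ I₂ : Set (Fin n))
    (hI₁ : ∀ a ∈ I₁, ∀ b, le b a → b ∈ I₁)
    (hI₂ : ∀ a ∈ I₂, ∀ b, le b a → b ∈ I₂)
    (hno : ¬ ∃ i : Fin n, (i ∈ I₁ ↔ i ∈ I₂)) :
    (I₁ = Set.univ ∧ I₂ = ∅) ∨ (I₁ = ∅ ∧ I₂ = Set.univ) := by
  have hcompl : I₂ = I₁ᶜ := by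
    ext i
    have := not_exists.mp hno i
    rw [Set.mem_compl_iff]
    tauto
  subst hcompl
  have hle : ∀ i j, le i j → (i ∈ I₁ ↔ j ∈ I₁) := fun i j hij =>
    ⟨fun hi => by_contra fun hj => hI₂ j hj i hij hi, fun hj => hI₁ j hj i hij⟩
  have hzero : ∀ k (hk : k < n), (⟨k, hk⟩ : Fin n) ∈ I₁ ↔ (⟨0, hn⟩ : Fin n) ∈ I₁ := by
    intro k
    induction k with
    | zero => exact fun _ => Iff.rfl
    | succ k ih =>
      intro hk
      rw [← ih (Nat.lt_of_succ_lt hk)]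
      exact (hcomp ⟨k, Nat.lt_of_succ_lt hk⟩ hk).elim (fun h => (hle _ _ h).symm) (hle _ _)
  by_cases h0 : (⟨0, hn⟩ : Fin n) ∈ I₁
  · have huniv : I₁ = Set.univ := Set.eq_univ_of_forall fun i => (hzero i i.2).mpr h0
    exact Or.inl ⟨huniv, by rw [huniv, Set.compl_univ]⟩
  · have hempty : I₁ = ∅ := Set.eq_empty_of_forall_notMem fun i hi => h0 ((hzero i i.2).mp hi)
    exact Or.inr ⟨hempty, by rw [hempty, Set.compl_empty]⟩
end

section
/- Let P be a finite partially ordered set, let x ∈ P, let K be a commutative semiring, and let w : P → K. Then the sum over all lower sets I of P of ∏_{y ∈ I} w(y) equals the sum over all lower sets I of the induced subposet {y ∈ P : ¬(x ≤ y)} of ∏_{y ∈ I} w(y), plus (∏_{y ∈ P, y ≤ x} w(y)) times the sum over all lower sets I of the induced subposet {y ∈ P : ¬(y ≤ x)} of ∏_{y ∈ I} w(y). Moreover, the identity is realized by the explicit map Φ sending a lower set I of P to I itself if x ∉ I, and to I ∖ {y : y ≤ x} if x ∈ I; Φ is a bijection from the lower sets of P onto the disjoint union of the lower sets of P minus the principal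 filter of x and the lower sets of P minus the principal ideal of x. -/
/-!
The combinatorial core of Proposition 4.1(1) of the paper.  For a finite poset `P`,
an element `x ∈ P`, and a weight function `w : P → K` into a commutative semiring,
the weighted sum over lower sets of `P` splits as the weighted sum over lower sets of
the induced subposet `{y : ¬ x ≤ y}` (P minus the principal filter of `x`) plus
`(∏_{y ≤ x} w y)` times the weighted sum over lower sets of the induced subposet
`{y : ¬ y ≤ x}` (P minus the principal ideal of `x`).  The identity is realized by the
map `Φ` sending a lower set `I` to `I` itself if `x ∉ I`, and to `I \ {y : y ≤ x}` if
`x ∈ I`; `Φ` restricts to bijections from the two parts of its domain onto the two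
components of the disjoint union.
-/

attribute [local instance] Classical.propDecidable

noncomputable section

/-- The lower sets of the subposet of `P` induced on the finite set `T`:
subsets `I ⊆ T` such that `a ∈ I`, `b ∈ T`, `b ≤ a` imply `b ∈ I`. -/
def lowerSetsIn {P : Type*} [PartialOrder P] (T : Finset P) : Finset (Finset P) :=
  T.powerset.filter (fun I => ∀ a ∈ I, ∀ b ∈ T, b ≤ a → b ∈ I)

theorem mem_lowerSetsIn {P : Type*} [PartialOrder P] {T I : Finset P} :
    I ∈ lowerSetsIn T ↔ I ⊆ T ∧ ∀ a ∈ I, ∀ b ∈ T, b ≤ a → b ∈ I := by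
  simp [lowerSetsIn]

/-- The lower sets of `P` avoiding `x` are the lower sets of the complement of the principal
filter of `x`. -/
theorem mem_lowerSetsIn_univ_and_notMem_iff {P : Type*} [Fintype P] [PartialOrder P]
    {x : P} {I : Finset P} :
    I ∈ lowerSetsIn (Finset.univ : Finset P) ∧ x ∉ I ↔
      I ∈ lowerSetsIn (Finset.univ.filter fun y : P => ¬ x ≤ y) := by
  simp only [mem_lowerSetsIn, Finset.subset_iff, Finset.mem_filter, imp_true_iff,
    Finset.mem_univ, true_and, true_imp_iff]
  constructor
  · rintro ⟨hI, hx⟩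
    exact ⟨fun a ha hxa => hx (hI a ha x hxa), fun a ha b _ hba => hI a ha b hba⟩
  · rintro ⟨hx, hI⟩
    exact ⟨fun a ha b hba => hI a ha b (fun hxb => hx ha (hxb.trans hba)) hba,
      fun h => hx h le_rfl⟩

/-- Removing the principal ideal of `x` is a bijection from the lower sets of `P` containing `x`
to the lower sets of the complement of that ideal. -/
theorem bijOn_filter_not_le {P : Type*} [Fintype P] [PartialOrder P] (x : P) :
    Set.BijOn (fun I : Finset P => I.filter (fun y => ¬ y ≤ x))
      {I : Finset P | I ∈ lowerSetsIn (Finset.univ : Finset P) ∧ x ∈ I}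
      {I : Finset P | I ∈ lowerSetsIn (Finset.univ.filter fun y : P => ¬ y ≤ x)} := by
  simp only [mem_lowerSetsIn, Finset.subset_univ, Finset.mem_univ, true_and, true_imp_iff]
  refine Set.InvOn.bijOn (f' := fun I => I ∪ Finset.univ.filter fun y => y ≤ x)
    ⟨?_, ?_⟩ ?_ ?_
  · rintro I ⟨hI, hx⟩
    ext y
    have := hI x hx y
    simp only [Finset.mem_union, Finset.mem_filter, Finset.mem_univ, true_and]
    tauto
  · rintro I ⟨hsub, -⟩
    ext y
    have := @hsub y
    simp only [Finset.mem_union, Finset.mem_filter, Finset.mem_univ, true_and] at this ⊢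
    tauto
  · rintro I ⟨hI, -⟩
    refine ⟨Finset.filter_subset_filter _ (Finset.subset_univ I), fun a ha b hb hba => ?_⟩
    simp only [Finset.mem_filter, Finset.mem_univ, true_and] at ha hb ⊢
    exact ⟨hI a ha.1 b hba, hb⟩
  · rintro I ⟨-, hI⟩
    simp only [Finset.mem_filter, Finset.mem_univ, true_and] at hI
    simp only [Set.mem_ofPred_eq, Finset.mem_union, Finset.mem_filter, Finset.mem_univ, true_and,
      le_refl, or_true, and_true]
    rintro a (ha | ha) b hba
    · by_cases hb : b ≤ x
      · exact Or.inr hb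
      · exact Or.inl (hI a ha b hb hba)
    · exact Or.inr (hba.trans ha)

theorem lowerSet_sum_split_at_element
    (P : Type*) [Fintype P] [PartialOrder P] (x : P)
    (K : Type*) [CommSemiring K] (w : P → K) :
    ((∑ I ∈ lowerSetsIn (Finset.univ : Finset P), ∏ y ∈ I, w y)
      = (∑ I ∈ lowerSetsIn (Finset.univ.filter fun y : P => ¬ x ≤ y), ∏ y ∈ I, w y)
        + (∏ y ∈ Finset.univ.filter fun y : P => y ≤ x, w y) *
          (∑ I ∈ lowerSetsIn (Finset.univ.filter fun y : P => ¬ y ≤ x), ∏ y ∈ I, w y))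
    ∧ Set.BijOn (fun I : Finset P => if x ∈ I then I.filter (fun y => ¬ y ≤ x) else I)
        {I : Finset P | I ∈ lowerSetsIn (Finset.univ : Finset P) ∧ x ∉ I}
        {I : Finset P | I ∈ lowerSetsIn (Finset.univ.filter fun y : P => ¬ x ≤ y)}
    ∧ Set.BijOn (fun I : Finset P => if x ∈ I then I.filter (fun y => ¬ y ≤ x) else I)
        {I : Finset P | I ∈ lowerSetsIn (Finset.univ : Finset P) ∧ x ∈ I}
        {I : Finset P | I ∈ lowerSetsIn (Finset.univ.filter fun y : P => ¬ y ≤ x)} := by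
  have hbij := bijOn_filter_not_le x
  refine ⟨?_, ?_, ?_⟩
  · rw [← Finset.sum_filter_not_add_sum_filter _ (fun I : Finset P => x ∈ I)]
    congr 1
    · refine Finset.sum_congr ?_ fun _ _ => rfl
      ext I
      rw [Finset.mem_filter, mem_lowerSetsIn_univ_and_notMem_iff]
    · rw [Finset.mul_sum]
      refine Finset.sum_nbij (fun I => I.filter fun y => ¬ y ≤ x)
        (fun I hI => hbij.mapsTo (Finset.mem_filter.mp hI)) ?_ ?_ fun I hI => ?_
      · rw [Finset.coe_filter]; exact hbij.injOn
      · rw [Finset.coe_filter]; exact hbij.surjOn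
      · obtain ⟨hI, hx⟩ := Finset.mem_filter.mp hI
        have hideal : (Finset.univ.filter fun y : P => y ≤ x) = I.filter fun y => y ≤ x := by
          ext y
          simpa using (mem_lowerSetsIn.mp hI).2 x hx y (Finset.mem_univ y)
        rw [hideal, Finset.prod_filter_mul_prod_filter_not]
  · simp only [← mem_lowerSetsIn_univ_and_notMem_iff]
    exact (Set.bijOn_id _).congr fun I hI => (if_neg hI.2).symm
  · exact hbij.congr fun I hI => (if_pos hI.2).symm
end
end

section
/- Let K be a commutative semiring, t ≥ 1, and let R be a fence on r₁, …, r_t (for each 1 ≤ i < t one chosen generating relation, either r_i ≺ r_{i+1} or r_{i+1} ≺ r_i). Let m ≥ 2, h ≥ 2, take fresh elements σ₁, …, σ_m and η₁, …, η_h, and fix weights u_i = w(r_i), s_i = w(σ_i), v_j = w(η_j) in K. Define: P_p on {r₁, …, r_t} ∪ {σ₁, …, σ_m} with the fence relations of R, the chain σ₁ ≺ ⋯ ≺ σ_m, and σ₁ ≺ r₁, r₁ ≺ σ_m; P_q on {r₁, …, r_t} ∪ {η₁, …, η_h} with the fence relations of R, the chain η₁ ≺ ⋯ ≺ η_h, and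 η₁ ≺ r_t, r_t ≺ η_h; and L on two disjoint copies R′, R″ of the fence R together with the σ's and η's, with the fence relations on each copy, the chains σ₁ ≺ ⋯ ≺ σ_m and η₁ ≺ ⋯ ≺ η_h, and σ₁ ≺ r′₁, r′_t ≺ η_h, η₁ ≺ r″_t, r″₁ ≺ σ_m, where both copies of r_i carry the weight u_i. Then Z(P_p) · Z(P_q) = Z(L) + (∏_{i=1}^{m} s_i)(∏_{i=1}^{t} u_i) + (∏_{j=1}^{h} v_j)(∏_{i=1}^{t} u_i). -/
/-!
The combinatorial content of the last claim of Proposition 4.5 of the paper, in the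
down-set formalism: for two singly-notched arcs `γ₁^{(p)}`, `γ₂^{(q)}` with the same
underlying arc (crossing the fence `R`, with spokes `σ₁, …, σ_m` at `p` and
`η₁, …, η_h` at `q`), one has
`Z(P_p) · Z(P_q) = Z(L) + (∏ s_i)(∏ u_i) + (∏ v_j)(∏ u_i)`,
where `P_p`, `P_q` are the loop fence posets of the two singly-notched arcs and `L` is
the poset of the closed curve `ℓ₁` (built from two disjoint copies of the fence `R`).
-/

attribute [local instance] Classical.propDecidable

noncomputable section

/-- The ideal sum of a configuration: the sum, over all down-sets `S` of the ground set
(`S ⊆ ground`, closed under the generating relations: `rel x y` with `x ∈ ground` and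
`y ∈ S` implies `x ∈ S`), of the product of the weights of the elements of `S`. -/
def idealSum {α K : Type*} [CommSemiring K]
    (ground : Finset α) (rel : α → α → Prop) (w : α → K) : K :=
  ∑ S ∈ ground.powerset.filter
      (fun S => ∀ x ∈ ground, ∀ y ∈ S, rel x y → x ∈ S),
    ∏ x ∈ S, w x

/-- The generating chain `f lo ≺ f (lo+1) ≺ ⋯ ≺ f hi`. -/
def chainRel {α : Type*} (f : ℕ → α) (lo hi : ℕ) : α → α → Prop :=
  fun p q => ∃ i, lo ≤ i ∧ i + 1 ≤ hi ∧ p = f i ∧ q = f (i + 1)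

/-- The single generating relation `u ≺ v`. -/
def covRel {α : Type*} (u v : α) : α → α → Prop := fun p q => p = u ∧ q = v

/-- A fence on `f 1, …, f t`: for each `1 ≤ i < t` one chosen generating relation,
either `f i ≺ f (i+1)` (when `ε i = true`) or `f (i+1) ≺ f i` (when `ε i = false`). -/
def fenceRel {α : Type*} (f : ℕ → α) (t : ℕ) (ε : ℕ → Bool) : α → α → Prop :=
  fun p q => ∃ i, 1 ≤ i ∧ i + 1 ≤ t ∧
    ((ε i = true ∧ p = f i ∧ q = f (i + 1)) ∨
     (ε i = false ∧ p = f (i + 1) ∧ q = f i))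

/-- The elements `f lo, …, f hi`. -/
def natGround {α : Type*} (f : ℕ → α) (lo hi : ℕ) : Finset α := (Finset.Icc lo hi).image f

/-- First copy `R′` of the fence (also the copy of `R` used in `P_p` and `P_q`). -/
def er1 : ℕ → (ℕ ⊕ ℕ) ⊕ (ℕ ⊕ ℕ) := fun i => Sum.inl (Sum.inl i)

/-- Second copy `R″` of the fence. -/
def er2 : ℕ → (ℕ ⊕ ℕ) ⊕ (ℕ ⊕ ℕ) := fun i => Sum.inl (Sum.inr i)

/-- The spokes `σ₁, …, σ_m` at `p`. -/
def es : ℕ → (ℕ ⊕ ℕ) ⊕ (ℕ ⊕ ℕ) := fun i => Sum.inr (Sum.inl i)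

/-- The spokes `η₁, …, η_h` at `q`. -/
def ee : ℕ → (ℕ ⊕ ℕ) ⊕ (ℕ ⊕ ℕ) := fun j => Sum.inr (Sum.inr j)

/-- `A` is closed under the generating relations of the fence on `1, …, t`. -/
def FenceClosed (t : ℕ) (ε : ℕ → Bool) (A : Finset ℕ) : Prop :=
  ∀ i, 1 ≤ i → i + 1 ≤ t →
    (ε i = true → i + 1 ∈ A → i ∈ A) ∧ (ε i = false → i ∈ A → i + 1 ∈ A)

/-- The weight of `A` if it is a down-set of the fence, and `0` otherwise. -/
def fenceWeight {K : Type*} [CommSemiring K] (t : ℕ) (ε : ℕ → Bool) (u : ℕ → K)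
    (A : Finset ℕ) : K :=
  if FenceClosed t ε A then ∏ i ∈ A, u i else 0

/-- The sum over the down-sets of the fence for which membership of the first and of the last
element is prescribed by `x` and `y`. -/
def fenceSum {K : Type*} [CommSemiring K] (t : ℕ) (ε : ℕ → Bool) (u : ℕ → K)
    (x y : Bool) : K :=
  ∑ A ∈ (Finset.Icc 1 t).powerset,
    if decide (1 ∈ A) = x ∧ decide (t ∈ A) = y then fenceWeight t ε u A else 0

lemma sum_fenceWeight_mul {K : Type*} [CommSemiring K] (t : ℕ) (ε : ℕ → Bool) (u : ℕ → K)
    (g : Bool → Bool → K) :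
    ∑ A ∈ (Finset.Icc 1 t).powerset, fenceWeight t ε u A * g (decide (1 ∈ A)) (decide (t ∈ A)) =
      ∑ x, ∑ y, fenceSum t ε u x y * g x y := by
  simp only [fenceSum, Fintype.sum_bool, Finset.sum_mul, ← Finset.sum_add_distrib]
  refine Finset.sum_congr rfl fun A _ => ?_
  by_cases h1 : 1 ∈ A <;> by_cases h2 : t ∈ A <;> simp [h1, h2]

lemma fenceSum_one {K : Type*} [CommSemiring K] (ε : ℕ → Bool) (u : ℕ → K) (x y : Bool) :
    fenceSum 1 ε u x y = if x = y then (if x then u 1 else 1) else 0 := by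
  have hc (A : Finset ℕ) : FenceClosed 1 ε A := fun i h1 h2 => by omega
  have hp : (Finset.Icc 1 1).powerset = {∅, {1}} := by decide
  have hne : (∅ : Finset ℕ) ≠ {1} := by decide
  rw [fenceSum, hp, Finset.sum_pair hne]
  cases x <;> cases y <;> simp [fenceWeight, hc]

lemma fenceClosed_succ {t : ℕ} (ht : 1 ≤ t) (ε : ℕ → Bool) (A : Finset ℕ) :
    FenceClosed (t + 1) ε A ↔ FenceClosed t ε A ∧
      (ε t = true → t + 1 ∈ A → t ∈ A) ∧ (ε t = false → t ∈ A → t + 1 ∈ A) := by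
  refine ⟨fun h => ⟨fun i h1 h2 => h i h1 (by omega), h t ht le_rfl⟩, fun ⟨h, h'⟩ i h1 h2 => ?_⟩
  rcases Nat.lt_or_ge i t with hi | hi
  · exact h i h1 hi
  · obtain rfl : i = t := by omega
    exact h'

lemma fenceClosed_insert {t : ℕ} (ε : ℕ → Bool) (A : Finset ℕ) :
    FenceClosed t ε (insert (t + 1) A) ↔ FenceClosed t ε A := by
  refine forall_congr' fun i => forall_congr' fun _ => forall_congr' fun hi => ?_
  have h1 : i ≠ t + 1 := by omega
  have h2 : i ≠ t := by omega
  simp [h1, h2]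

lemma fenceSum_succ {K : Type*} [CommSemiring K] {t : ℕ} (ht : 1 ≤ t) (ε : ℕ → Bool)
    (u : ℕ → K) (x : Bool) :
    fenceSum (t + 1) ε u x true = (fenceSum t ε u x true +
        if ε t = true then 0 else fenceSum t ε u x false) * u (t + 1) ∧
      fenceSum (t + 1) ε u x false = fenceSum t ε u x false +
        if ε t = true then fenceSum t ε u x true else 0 := by
  have hI : Finset.Icc 1 (t + 1) = insert (t + 1) (Finset.Icc 1 t) := by
    ext i; simp only [Finset.mem_Icc, Finset.mem_insert]; omega
  have hn : t + 1 ∉ Finset.Icc 1 t := by simp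
  have h0 : t ≠ 0 := by omega
  constructor <;> cases hε : ε t <;>
  · simp only [fenceSum, hI, Finset.sum_powerset_insert hn, ← Finset.sum_add_distrib,
      if_true, if_false, Bool.false_eq_true, add_zero, Finset.sum_mul]
    refine Finset.sum_congr rfl fun A hA => ?_
    have hA' : t + 1 ∉ A := fun h => hn (Finset.mem_powerset.1 hA h)
    have hw := Finset.prod_insert (f := u) hA'
    simp only [fenceWeight, fenceClosed_succ ht, fenceClosed_insert, hw, hε]
    by_cases h1 : 1 ∈ A <;> by_cases h2 : t ∈ A <;> by_cases h3 : FenceClosed t ε A <;>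
      cases x <;> simp [h1, h2, h3, hA', h0, mul_comm]

/-- The determinant of the matrix of end-point-constrained fence sums is the total weight. -/
lemma fenceSum_mul_fenceSum {K : Type*} [CommSemiring K] {t : ℕ} (ht : 1 ≤ t) (ε : ℕ → Bool)
    (u : ℕ → K) :
    fenceSum t ε u true true * fenceSum t ε u false false =
      fenceSum t ε u false true * fenceSum t ε u true false + ∏ i ∈ Finset.Icc 1 t, u i := by
  induction t, ht using Nat.le_induction with
  | base => simp [fenceSum_one]
  | succ t ht ih =>
    rw [Finset.prod_Icc_succ_top (by omega), (fenceSum_succ ht ε u true).1,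
      (fenceSum_succ ht ε u true).2, (fenceSum_succ ht ε u false).1,
      (fenceSum_succ ht ε u false).2]
    cases ε t
    · simp only [Bool.false_eq_true, if_false]
      calc _ = (fenceSum t ε u true true * fenceSum t ε u false false +
            fenceSum t ε u true false * fenceSum t ε u false false) * u (t + 1) := by ring
        _ = _ := by rw [ih]; ring
    · simp only [if_true]
      calc _ = (fenceSum t ε u true true * fenceSum t ε u false false +
            fenceSum t ε u true true * fenceSum t ε u false true) * u (t + 1) := by ring
        _ = _ := by rw [ih]; ring

lemma fenceSum_chain {K : Type*} [CommSemiring K] {m : ℕ} (hm : 1 ≤ m) (s : ℕ → K) :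
    fenceSum m (fun _ => true) s false true = 0 ∧
      fenceSum m (fun _ => true) s false false = 1 ∧
      fenceSum m (fun _ => true) s true true = ∏ i ∈ Finset.Icc 1 m, s i := by
  induction m, hm using Nat.le_induction with
  | base => simp [fenceSum_one]
  | succ m hm ih =>
    obtain ⟨h1, h2, h3⟩ := ih
    rw [Finset.prod_Icc_succ_top (by omega), (fenceSum_succ hm _ s true).1,
      (fenceSum_succ hm _ s false).1, (fenceSum_succ hm _ s false).2]
    simp [h1, h2, h3]

/-- `S` is closed under those generating relations whose lower element lies in `ground`. -/
def RelClosed {α : Type*} (ground : Finset α) (rel : α → α → Prop) (S : Finset α) : Prop :=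
  ∀ x ∈ ground, ∀ y ∈ S, rel x y → x ∈ S

lemma relClosed_sup {α : Type*} (G : Finset α) (r r' : α → α → Prop) (S : Finset α) :
    RelClosed G (r ⊔ r') S ↔ RelClosed G r S ∧ RelClosed G r' S :=
  ⟨fun h => ⟨fun x hx y hy hr => h x hx y hy (Or.inl hr),
    fun x hx y hy hr => h x hx y hy (Or.inr hr)⟩,
    fun h x hx y hy hr => hr.elim (h.1 x hx y hy) (h.2 x hx y hy)⟩

lemma relClosed_covRel {α : Type*} {G : Finset α} {a b : α} (ha : a ∈ G) (S : Finset α) :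
    RelClosed G (covRel a b) S ↔ (b ∈ S → a ∈ S) := by
  constructor
  · exact fun h hb => h a ha b hb ⟨rfl, rfl⟩
  · rintro h x - y hy ⟨rfl, rfl⟩
    exact h hy

lemma relClosed_fenceRel {α : Type*} {G S : Finset α} {f : ℕ → α} {t : ℕ} (ε : ℕ → Bool)
    {A : Finset ℕ} (hf : ∀ i ∈ Finset.Icc 1 t, f i ∈ G) (hS : ∀ i, f i ∈ S ↔ i ∈ A) :
    RelClosed G (fenceRel f t ε) S ↔ FenceClosed t ε A := by
  simp only [Finset.mem_Icc] at hf
  constructor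
  · intro h i h1 h2
    simp only [← hS]
    exact ⟨fun he hi => h _ (hf _ ⟨by omega, by omega⟩) _ hi ⟨i, h1, h2, Or.inl ⟨he, rfl, rfl⟩⟩,
      fun he hi => h _ (hf _ ⟨by omega, by omega⟩) _ hi ⟨i, h1, h2, Or.inr ⟨he, rfl, rfl⟩⟩⟩
  · rintro h x - y hy ⟨i, h1, h2, ⟨he, rfl, rfl⟩ | ⟨he, rfl, rfl⟩⟩
    · exact (hS _).2 ((h i h1 h2).1 he ((hS _).1 hy))
    · exact (hS _).2 ((h i h1 h2).2 he ((hS _).1 hy))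

lemma chainRel_eq_fenceRel {α : Type*} (f : ℕ → α) (m : ℕ) :
    chainRel f 1 m = fenceRel f m (fun _ => true) := by
  ext p q
  simp [chainRel, fenceRel]

lemma mem_natGround {α : Type*} {f : ℕ → α} {lo hi : ℕ} {x : α} :
    x ∈ natGround f lo hi ↔ ∃ i ∈ Finset.Icc lo hi, f i = x :=
  Finset.mem_image

lemma apply_mem_natGround {α : Type*} (f : ℕ → α) {lo hi i : ℕ} (h : i ∈ Finset.Icc lo hi) :
    f i ∈ natGround f lo hi :=
  mem_natGround.2 ⟨i, h, rfl⟩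

lemma sum_powerset_union_natGround {α K : Type*} [DecidableEq α] [CommSemiring K] {f : ℕ → α}
    (hf : Function.Injective f) {G : Finset α} {t : ℕ} (hG : ∀ i, f i ∉ G) (φ : Finset α → K) :
    ∑ S ∈ (G ∪ natGround f 1 t).powerset, φ S =
      ∑ S ∈ G.powerset, ∑ A ∈ (Finset.Icc 1 t).powerset, φ (S ∪ A.image f) := by
  have key (S : Finset α) (hS : S ⊆ G) (A : Finset ℕ) :
      (S ∪ A.image f).filter (· ∈ G) = S ∧ ∀ i, f i ∈ S ∪ A.image f ↔ i ∈ A := by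
    constructor
    · ext x
      simp only [Finset.mem_filter, Finset.mem_union, Finset.mem_image]
      constructor
      · rintro ⟨h | ⟨i, -, rfl⟩, hx⟩
        · exact h
        · exact absurd hx (hG i)
      · exact fun h => ⟨Or.inl h, hS h⟩
    · intro i
      have : f i ∉ S := fun h => hG i (hS h)
      simp [this, hf.eq_iff]
  rw [← Finset.sum_product']
  symm
  refine Finset.sum_bij (fun p _ => p.1 ∪ p.2.image f) ?_ ?_ ?_ fun _ _ => rfl
  · rintro ⟨S, A⟩ h
    simp only [Finset.mem_product, Finset.mem_powerset] at h
    refine Finset.mem_powerset.2 (Finset.union_subset_union h.1 fun x hx => ?_)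
    obtain ⟨i, hi, rfl⟩ := Finset.mem_image.1 hx
    exact apply_mem_natGround f (h.2 hi)
  · rintro ⟨S, A⟩ h ⟨S', A'⟩ h' e
    simp only [Finset.mem_product, Finset.mem_powerset] at h h' e
    ext1
    · change S = S'
      rw [← (key S h.1 A).1, ← (key S' h'.1 A').1, e]
    · ext i
      rw [← (key S h.1 A).2, ← (key S' h'.1 A').2, e]
  · intro T hT
    have hT := Finset.mem_powerset.1 hT
    refine ⟨(T.filter (· ∈ G), (Finset.Icc 1 t).filter (f · ∈ T)), ?_, ?_⟩
    · simp only [Finset.mem_product, Finset.mem_powerset]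
      exact ⟨fun x hx => (Finset.mem_filter.1 hx).2, Finset.filter_subset _ _⟩
    · ext x
      simp only [Finset.mem_union, Finset.mem_filter, Finset.mem_image]
      constructor
      · rintro (h | ⟨i, h, rfl⟩)
        exacts [h.1, h.2]
      · intro hx
        rcases Finset.mem_union.1 (hT hx) with h | h
        · exact Or.inl ⟨hx, h⟩
        · obtain ⟨i, hi, rfl⟩ := mem_natGround.1 h
          exact Or.inr ⟨i, ⟨hi, hx⟩, rfl⟩

lemma sum_powerset_natGround {α K : Type*} [DecidableEq α] [CommSemiring K] {f : ℕ → α}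
    (hf : Function.Injective f) {t : ℕ} (φ : Finset α → K) :
    ∑ S ∈ (natGround f 1 t).powerset, φ S =
      ∑ A ∈ (Finset.Icc 1 t).powerset, φ (A.image f) := by
  simpa using sum_powerset_union_natGround hf (G := ∅) (t := t) (by simp) φ

lemma idealSum_eq_sum_ite {α K : Type*} [CommSemiring K] (G : Finset α) (r : α → α → Prop)
    (w : α → K) :
    idealSum G r w = ∑ S ∈ G.powerset, if RelClosed G r S then ∏ x ∈ S, w x else 0 := by
  rw [idealSum, Finset.sum_filter]
  refine Finset.sum_congr rfl fun S _ => ?_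
  by_cases h : RelClosed G r S
  · exact (if_pos h).trans (if_pos h).symm
  · exact (if_neg h).trans (if_neg h).symm

/-- The ideal sum of a loop fence, where `k` is the end of the fence (`1` or `t`) at the notch. -/
lemma idealSum_loop {α K : Type*} [DecidableEq α] [CommSemiring K] {f g : ℕ → α} (hf : Function.Injective f)
    (hg : Function.Injective g) (hfg : ∀ i j, f i ≠ g j) {t m : ℕ} (hm : 1 ≤ m)
    (ε : ℕ → Bool) {k : ℕ} (hk : k ∈ Finset.Icc 1 t) (w : α → K) :
    idealSum (natGround f 1 t ∪ natGround g 1 m)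
        (fenceRel f t ε ⊔ chainRel g 1 m ⊔ covRel (g 1) (f k) ⊔ covRel (f k) (g m)) w =
      ∑ A ∈ (Finset.Icc 1 t).powerset, ∑ C ∈ (Finset.Icc 1 m).powerset,
        fenceWeight t ε (w ∘ f) A * (fenceWeight m (fun _ => true) (w ∘ g) C *
          if (k ∈ A → 1 ∈ C) ∧ (m ∈ C → k ∈ A) then 1 else 0) := by
  have hgf (i : ℕ) : g i ∉ natGround f 1 t := by simp [natGround, hfg]
  rw [idealSum_eq_sum_ite, sum_powerset_union_natGround hg hgf, sum_powerset_natGround hf]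
  refine Finset.sum_congr rfl fun A _ => Finset.sum_congr rfl fun C _ => ?_
  have hA (i : ℕ) : f i ∈ A.image f ∪ C.image g ↔ i ∈ A := by
    simp [hf.eq_iff, (hfg _ _).symm]
  have hC (i : ℕ) : g i ∈ A.image f ∪ C.image g ↔ i ∈ C := by
    simp [hg.eq_iff, hfg]
  have hGf (i : ℕ) (hi : i ∈ Finset.Icc 1 t) : f i ∈ natGround f 1 t ∪ natGround g 1 m :=
    Finset.mem_union_left _ (apply_mem_natGround _ hi)
  have hGg (i : ℕ) (hi : i ∈ Finset.Icc 1 m) : g i ∈ natGround f 1 t ∪ natGround g 1 m :=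
    Finset.mem_union_right _ (apply_mem_natGround _ hi)
  have hd : Disjoint (A.image f) (C.image g) := by
    simp [Finset.disjoint_left, (hfg _ _).symm]
  simp only [chainRel_eq_fenceRel, relClosed_sup, relClosed_fenceRel _ hGf hA,
    relClosed_fenceRel _ hGg hC, relClosed_covRel (hGg 1 (by simpa using hm)),
    relClosed_covRel (hGf k hk), hA, hC, Finset.prod_union hd, Finset.prod_image hf.injOn,
    Finset.prod_image hg.injOn, fenceWeight, Function.comp_apply]
  by_cases h1 : FenceClosed t ε A <;> by_cases h2 : FenceClosed m (fun _ => true) C <;>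
    simp [h1, h2]

/-- The ideal sum of the configuration of a closed curve formed by two copies of a fence,
joined through two chains. -/
lemma idealSum_band {K : Type*} [CommSemiring K] {t m h : ℕ} (ht : 1 ≤ t) (hm : 1 ≤ m)
    (hh : 1 ≤ h) (ε : ℕ → Bool) (w : (ℕ ⊕ ℕ) ⊕ (ℕ ⊕ ℕ) → K) :
    idealSum
        (natGround er1 1 t ∪ natGround er2 1 t ∪ natGround es 1 m ∪ natGround ee 1 h)
        (fenceRel er1 t ε ⊔ fenceRel er2 t ε ⊔ chainRel es 1 m ⊔ chainRel ee 1 h ⊔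
          covRel (es 1) (er1 1) ⊔ covRel (er1 t) (ee h) ⊔
          covRel (ee 1) (er2 t) ⊔ covRel (er2 1) (es m)) w =
      ∑ A ∈ (Finset.Icc 1 t).powerset, ∑ B ∈ (Finset.Icc 1 t).powerset,
        ∑ C ∈ (Finset.Icc 1 m).powerset, ∑ D ∈ (Finset.Icc 1 h).powerset,
          fenceWeight t ε (w ∘ er1) A * (fenceWeight t ε (w ∘ er2) B *
            (fenceWeight m (fun _ => true) (w ∘ es) C *
              (fenceWeight h (fun _ => true) (w ∘ ee) D *
                if (1 ∈ A → 1 ∈ C) ∧ (h ∈ D → t ∈ A) ∧ (t ∈ B → 1 ∈ D) ∧ (m ∈ C → 1 ∈ B)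
                then 1 else 0))) := by
  have i1 : Function.Injective er1 := Sum.inl_injective.comp Sum.inl_injective
  have i2 : Function.Injective er2 := Sum.inl_injective.comp Sum.inr_injective
  have i3 : Function.Injective es := Sum.inr_injective.comp Sum.inl_injective
  have i4 : Function.Injective ee := Sum.inr_injective.comp Sum.inr_injective
  rw [idealSum_eq_sum_ite, sum_powerset_union_natGround i4 (by simp [natGround, er1, er2, es, ee]),
    sum_powerset_union_natGround i3 (by simp [natGround, er1, er2, es]),
    sum_powerset_union_natGround i2 (by simp [natGround, er1, er2]), sum_powerset_natGround i1]
  refine Finset.sum_congr rfl fun A _ => Finset.sum_congr rfl fun B _ =>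
    Finset.sum_congr rfl fun C _ => Finset.sum_congr rfl fun D _ => ?_
  set G := natGround er1 1 t ∪ natGround er2 1 t ∪ natGround es 1 m ∪ natGround ee 1 h with hG
  have g1 (i : ℕ) (hi : i ∈ Finset.Icc 1 t) : er1 i ∈ G := by
    simp only [hG, Finset.mem_union]
    exact Or.inl (Or.inl (Or.inl (apply_mem_natGround _ hi)))
  have g2 (i : ℕ) (hi : i ∈ Finset.Icc 1 t) : er2 i ∈ G := by
    simp only [hG, Finset.mem_union]
    exact Or.inl (Or.inl (Or.inr (apply_mem_natGround _ hi)))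
  have g3 (i : ℕ) (hi : i ∈ Finset.Icc 1 m) : es i ∈ G := by
    simp only [hG, Finset.mem_union]
    exact Or.inl (Or.inr (apply_mem_natGround _ hi))
  have g4 (i : ℕ) (hi : i ∈ Finset.Icc 1 h) : ee i ∈ G := by
    simp only [hG, Finset.mem_union]
    exact Or.inr (apply_mem_natGround _ hi)
  set S := A.image er1 ∪ B.image er2 ∪ C.image es ∪ D.image ee with hS
  have m1 (i : ℕ) : er1 i ∈ S ↔ i ∈ A := by simp [hS, er1, er2, es, ee]
  have m2 (i : ℕ) : er2 i ∈ S ↔ i ∈ B := by simp [hS, er1, er2, es, ee]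
  have m3 (i : ℕ) : es i ∈ S ↔ i ∈ C := by simp [hS, er1, er2, es, ee]
  have m4 (i : ℕ) : ee i ∈ S ↔ i ∈ D := by simp [hS, er1, er2, es, ee]
  have hp : ∏ x ∈ S, w x =
      (∏ i ∈ A, w (er1 i)) * (∏ i ∈ B, w (er2 i)) * (∏ i ∈ C, w (es i)) * ∏ i ∈ D, w (ee i) := by
    rw [hS, Finset.prod_union, Finset.prod_union, Finset.prod_union, Finset.prod_image i1.injOn,
      Finset.prod_image i2.injOn, Finset.prod_image i3.injOn, Finset.prod_image i4.injOn]
    all_goals simp [Finset.disjoint_left, er1, er2, es, ee, or_imp, forall_and]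
  simp only [chainRel_eq_fenceRel, relClosed_sup, relClosed_fenceRel _ g1 m1,
    relClosed_fenceRel _ g2 m2, relClosed_fenceRel _ g3 m3, relClosed_fenceRel _ g4 m4,
    relClosed_covRel (g1 t (by simpa using ht)), relClosed_covRel (g2 1 (by simpa using ht)),
    relClosed_covRel (g3 1 (by simpa using hm)), relClosed_covRel (g4 1 (by simpa using hh)),
    m1, m2, m3, m4, hp, fenceWeight, Function.comp_apply]
  by_cases h1 : FenceClosed t ε A <;> by_cases h2 : FenceClosed t ε B <;>
    by_cases h3 : FenceClosed m (fun _ => true) C <;>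
    by_cases h4 : FenceClosed h (fun _ => true) D <;>
    simp [h1, h2, h3, h4, and_assoc, mul_assoc]

lemma idealSum_loop_first {α K : Type*} [DecidableEq α] [CommSemiring K] {f g : ℕ → α}
    (hf : Function.Injective f) (hg : Function.Injective g) (hfg : ∀ i j, f i ≠ g j) {t m : ℕ}
    (ht : 1 ≤ t) (hm : 1 ≤ m) (ε : ℕ → Bool) (w : α → K) :
    idealSum (natGround f 1 t ∪ natGround g 1 m)
        (fenceRel f t ε ⊔ chainRel g 1 m ⊔ covRel (g 1) (f 1) ⊔ covRel (f 1) (g m)) w =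
      ∑ x, ∑ y, fenceSum t ε (w ∘ f) x y *
        ∑ x', ∑ y', fenceSum m (fun _ => true) (w ∘ g) x' y' *
          if (x = true → x' = true) ∧ (y' = true → x = true) then 1 else 0 := by
  rw [idealSum_loop hf hg hfg hm ε (by simpa using ht)]
  simp only [← sum_fenceWeight_mul]
  simp only [Finset.mul_sum, decide_eq_true_eq]

lemma idealSum_loop_last {α K : Type*} [DecidableEq α] [CommSemiring K] {f g : ℕ → α}
    (hf : Function.Injective f) (hg : Function.Injective g) (hfg : ∀ i j, f i ≠ g j) {t m : ℕ}
    (ht : 1 ≤ t) (hm : 1 ≤ m) (ε : ℕ → Bool) (w : α → K) :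
    idealSum (natGround f 1 t ∪ natGround g 1 m)
        (fenceRel f t ε ⊔ chainRel g 1 m ⊔ covRel (g 1) (f t) ⊔ covRel (f t) (g m)) w =
      ∑ x, ∑ y, fenceSum t ε (w ∘ f) x y *
        ∑ x', ∑ y', fenceSum m (fun _ => true) (w ∘ g) x' y' *
          if (y = true → x' = true) ∧ (y' = true → y = true) then 1 else 0 := by
  rw [idealSum_loop hf hg hfg hm ε (by simpa using ht)]
  simp only [← sum_fenceWeight_mul]
  simp only [Finset.mul_sum, decide_eq_true_eq]

lemma idealSum_band_eq_sum_bool {K : Type*} [CommSemiring K] {t m h : ℕ} (ht : 1 ≤ t)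
    (hm : 1 ≤ m) (hh : 1 ≤ h) (ε : ℕ → Bool) (w : (ℕ ⊕ ℕ) ⊕ (ℕ ⊕ ℕ) → K) :
    idealSum
        (natGround er1 1 t ∪ natGround er2 1 t ∪ natGround es 1 m ∪ natGround ee 1 h)
        (fenceRel er1 t ε ⊔ fenceRel er2 t ε ⊔ chainRel es 1 m ⊔ chainRel ee 1 h ⊔
          covRel (es 1) (er1 1) ⊔ covRel (er1 t) (ee h) ⊔
          covRel (ee 1) (er2 t) ⊔ covRel (er2 1) (es m)) w =
      ∑ a, ∑ a', fenceSum t ε (w ∘ er1) a a' * ∑ b, ∑ b', fenceSum t ε (w ∘ er2) b b' *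
        ∑ c, ∑ c', fenceSum m (fun _ => true) (w ∘ es) c c' *
          ∑ d, ∑ d', fenceSum h (fun _ => true) (w ∘ ee) d d' *
            if (a = true → c = true) ∧ (d' = true → a' = true) ∧ (b' = true → d = true) ∧
              (c' = true → b = true) then 1 else 0 := by
  rw [idealSum_band ht hm hh]
  simp only [← sum_fenceWeight_mul]
  simp only [Finset.mul_sum, decide_eq_true_eq]

theorem skein_two_singly_notched_same_underlying_arc
    (K : Type*) [CommSemiring K]
    (t : ℕ) (ht : 1 ≤ t) (ε : ℕ → Bool)
    (m h : ℕ) (hm : 2 ≤ m) (hh : 2 ≤ h)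
    (u s v : ℕ → K) :
    -- Z(P_p) · Z(P_q)
    idealSum
        (natGround er1 1 t ∪ natGround es 1 m)
        (fenceRel er1 t ε ⊔ chainRel es 1 m ⊔
          covRel (es 1) (er1 1) ⊔ covRel (er1 1) (es m))
        (Sum.elim (Sum.elim u u) (Sum.elim s v)) *
      idealSum
        (natGround er1 1 t ∪ natGround ee 1 h)
        (fenceRel er1 t ε ⊔ chainRel ee 1 h ⊔
          covRel (ee 1) (er1 t) ⊔ covRel (er1 t) (ee h))
        (Sum.elim (Sum.elim u u) (Sum.elim s v))
    -- = Z(L) + (∏s)(∏u) + (∏v)(∏u)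
    = idealSum
        (natGround er1 1 t ∪ natGround er2 1 t ∪ natGround es 1 m ∪ natGround ee 1 h)
        (fenceRel er1 t ε ⊔ fenceRel er2 t ε ⊔ chainRel es 1 m ⊔ chainRel ee 1 h ⊔
          covRel (es 1) (er1 1) ⊔ covRel (er1 t) (ee h) ⊔
          covRel (ee 1) (er2 t) ⊔ covRel (er2 1) (es m))
        (Sum.elim (Sum.elim u u) (Sum.elim s v))
      + (∏ i ∈ Finset.Icc 1 m, s i) * (∏ i ∈ Finset.Icc 1 t, u i)
      + (∏ j ∈ Finset.Icc 1 h, v j) * (∏ i ∈ Finset.Icc 1 t, u i) := by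
  have hm1 : 1 ≤ m := by omega
  have hh1 : 1 ≤ h := by omega
  have i1 : Function.Injective er1 := Sum.inl_injective.comp Sum.inl_injective
  have i3 : Function.Injective es := Sum.inr_injective.comp Sum.inl_injective
  have i4 : Function.Injective ee := Sum.inr_injective.comp Sum.inr_injective
  rw [idealSum_loop_first i1 i3 (by simp [er1, es]) ht hm1,
    idealSum_loop_last i1 i4 (by simp [er1, ee]) ht hh1, idealSum_band_eq_sum_bool ht hm1 hh1]
  set w : (ℕ ⊕ ℕ) ⊕ (ℕ ⊕ ℕ) → K := Sum.elim (Sum.elim u u) (Sum.elim s v)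
  have w1 : w ∘ er1 = u := rfl
  have w2 : w ∘ er2 = u := rfl
  have w3 : w ∘ es = s := rfl
  have w4 : w ∘ ee = v := rfl
  obtain ⟨s1, s2, s3⟩ := fenceSum_chain hm1 s
  obtain ⟨v1, v2, v3⟩ := fenceSum_chain hh1 v
  have hdet := fenceSum_mul_fenceSum ht ε u
  rw [w1, w2, w3, w4]
  simp only [Fintype.sum_bool, s1, s2, s3, v1, v2, v3, Bool.false_eq_true, imp_false,
    false_imp_iff, true_imp_iff, not_true, not_false_iff, and_true, true_and, and_false,
    false_and, implies_true, if_true, if_false, mul_zero, mul_one, add_zero, zero_add, zero_mul]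
  generalize fenceSum t ε u true true = z11 at *
  generalize fenceSum t ε u true false = z10 at *
  generalize fenceSum t ε u false true = z01 at *
  generalize fenceSum t ε u false false = z00 at *
  generalize fenceSum m (fun _ => true) s true false = x at *
  generalize fenceSum h (fun _ => true) v true false = y at *
  generalize ∏ i ∈ Finset.Icc 1 m, s i = σ at *
  generalize ∏ i ∈ Finset.Icc 1 h, v i = η at *
  generalize ∏ i ∈ Finset.Icc 1 t, u i = ρ at *
  have hl : ((z00 + z01) + x * (z00 + z01 + z10 + z11) + σ * (z10 + z11)) *
      ((z00 + z10) + y * (z00 + z01 + z10 + z11) + η * (z01 + z11)) =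
      (z11 * z00) * (σ + η) + ((z00 + z01) + x * (z00 + z01 + z10 + z11)) *
        ((z00 + z10) + y * (z00 + z01 + z10 + z11)) +
      σ * (z10 * z00 + z10 * z10 + z11 * z10) +
      σ * (z10 + z11) * (y * (z00 + z01 + z10 + z11) + η * (z01 + z11)) +
      η * (z00 * z01 + z01 * z01 + z01 * z11) +
      η * (z01 + z11) * (x * (z00 + z01 + z10 + z11)) := by ring
  rw [hdet] at hl
  refine Eq.trans ?_ (hl.trans ?_) <;> ring
end
end
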